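/- Under the setup, no component of the induced subgraph G*[U] is isomorphic to K_{1,r}+e for any r ≥ 2, where K_{1,r}+e is the star K_{1,r} with one extra edge between two leaves (K_{1,2}+e is a triangle). -/

import Mathlib

open SimpleGraph Finset
open scoped Classical

/-- The spectral radius of a finite simple graph: the largest eigenvalue of its
adjacency matrix (expressed as the supremum of the set of eigenvalues). -/
noncomputable def specRad {V : Type*} [Fintype V] (G : SimpleGraph V) : ℝ :=
  sSup {t : ℝ | Module.End.HasEigenvalue (Matrix.toLin' (G.adjMatrix ℝ)) t}

/-- The fan graph `F₆ = K₁ ∨ P₅`: the path `0-1-2-3-4` together with the hub `5`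
adjacent to all of `0,…,4`. -/
def fan6 : SimpleGraph (Fin 6) :=
  SimpleGraph.fromRel (fun a b => b = 5 ∨ (b.val = a.val + 1 ∧ b.val ≤ 4))

/-- A graph is `F₆`-free if it contains no subgraph isomorphic to the fan `F₆`,
i.e. there is no injective graph homomorphism from `F₆` into it. -/
def F6Free {V : Type*} (G : SimpleGraph V) : Prop :=
  ¬ ∃ f : fan6 →g G, Function.Injective f

/-- The join `K₂ ∨ kK₁`: two adjacent vertices, each adjacent to `k` further
pairwise non-adjacent vertices. -/
def K2JoinEmpty (k : ℕ) : SimpleGraph (Fin 2 ⊕ Fin k) :=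
  SimpleGraph.fromRel (fun a b => a.isLeft ∨ b.isLeft)

/-- `dS G S v` is the number of neighbors of `v` lying in `S`. -/
noncomputable def dS {V : Type*} (G : SimpleGraph V) (S : Set V) (v : V) : ℕ :=
  (G.neighborSet v ∩ S).ncard

/-- `eIn G S` is the number of edges of the induced subgraph `G[S]`. -/
noncomputable def eIn {V : Type*} (G : SimpleGraph V) (S : Set V) : ℕ :=
  {e ∈ G.edgeSet | ∀ v ∈ e, v ∈ S}.ncard

/-- `eBetween G S T` is the number of edges with one endpoint in `S` and the
other in `T`. -/
noncomputable def eBetween {V : Type*} (G : SimpleGraph V) (S T : Set V) : ℕ :=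
  {e ∈ G.edgeSet | ∃ a ∈ S, ∃ b ∈ T, e = s(a, b)}.ncard

/-- `gamma G x ustar S = Σ_{u∈S} (d_S(u) - 1)·x_u/x_{u*} - e(S)`. -/
noncomputable def gamma {V : Type*} [Fintype V] (G : SimpleGraph V) (x : V → ℝ)
    (ustar : V) (S : Set V) : ℝ :=
  (∑ u ∈ S.toFinset, ((dS G S u : ℝ) - 1) * (x u / x ustar)) - eIn G S

/-- The star `K_{1,r}` with center `0` and `r` leaves. -/
def starGraph (r : ℕ) : SimpleGraph (Fin (r + 1)) :=
  SimpleGraph.fromRel (fun a _ => a = 0)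

/-- `K_{1,r} + e`: the star with center `0` and `r` leaves, plus an edge joining
the two leaves `1` and `2`. -/
def starPlusEdge (r : ℕ) : SimpleGraph (Fin (r + 1)) :=
  SimpleGraph.fromRel (fun a b => a = 0 ∨ (a = 1 ∧ b = 2))

/-- The double star `D_{a,b}`: centers `0` and `1` joined by an edge, `0` joined
to the `a` leaves `2,…,a+1`, and `1` joined to the `b` leaves `a+2,…,a+b+1`. -/
def doubleStar (a b : ℕ) : SimpleGraph (Fin (a + b + 2)) :=
  SimpleGraph.fromRel (fun u v =>
    (u.val = 0 ∧ v.val = 1) ∨ (u.val = 0 ∧ 2 ≤ v.val ∧ v.val < a + 2) ∨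
      (u.val = 1 ∧ a + 2 ≤ v.val))

/-- `K₄ - e`: the complete graph on 4 vertices minus the edge `{0,1}`. -/
def K4MinusE : SimpleGraph (Fin 4) :=
  SimpleGraph.fromRel (fun u v => ¬(u = 0 ∧ v = 1) ∧ ¬(u = 1 ∧ v = 0))

/-- A fan-free graph has no path on five vertices inside the neighbourhood of a vertex. -/
theorem F6Free.no_path {V : Type*} {G : SimpleGraph V} (hG : F6Free G) {h p q r s t : V}
    (hp : G.Adj h p) (hq : G.Adj h q) (hr : G.Adj h r) (hs : G.Adj h s) (ht : G.Adj h t)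
    (hpq : G.Adj p q) (hqr : G.Adj q r) (hrs : G.Adj r s) (hst : G.Adj s t)
    (hpr : p ≠ r) (hps : p ≠ s) (hpt : p ≠ t) (hqs : q ≠ s) (hqt : q ≠ t) (hrt : r ≠ t) :
    False := by
  refine hG ⟨⟨![p, q, r, s, t, h], ?_⟩, ?_⟩
  · intro i j hij
    fin_cases i <;> fin_cases j <;>
      simp_all [fan6, G.adj_comm, SimpleGraph.fromRel_adj]
  · have := hp.ne; have := hq.ne; have := hr.ne; have := hs.ne; have := ht.ne
    have := hpq.ne; have := hqr.ne; have := hrs.ne; have := hst.ne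
    intro i j hij
    fin_cases i <;> fin_cases j <;> simp_all

/-- No path on five vertices (as a subgraph) lies inside `U`. -/
def PathFree {V : Type*} (G : SimpleGraph V) (U : Finset V) : Prop :=
  ∀ p ∈ U, ∀ q ∈ U, ∀ r ∈ U, ∀ s ∈ U, ∀ t ∈ U, G.Adj p q → G.Adj q r → G.Adj r s → G.Adj s t →
    p ≠ r → p ≠ s → p ≠ t → q ≠ s → q ≠ t → r ≠ t → False

/-- `b` and `c` are adjacent vertices of `U` with two common neighbours `a` and `d` in `U`. -/
structure IsDiamond {V : Type*} (G : SimpleGraph V) (U : Finset V) (a b c d : V) : Prop where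
  ha : a ∈ U
  hb : b ∈ U
  hc : c ∈ U
  hd : d ∈ U
  hab : G.Adj a b
  hac : G.Adj a c
  hbc : G.Adj b c
  hbd : G.Adj b d
  hcd : G.Adj c d
  had : a ≠ d

/-- The number of neighbours of `u` in `U`. -/
noncomputable def degIn {V : Type*} (G : SimpleGraph V) (U : Finset V) (u : V) : ℕ :=
  (U.filter (G.Adj u)).card

/-- The contribution of `u` to `gamma`, each edge being shared equally by its endpoints. -/
noncomputable def excess {V : Type*} (G : SimpleGraph V) (U : Finset V) (x : V → ℝ) (u : V) : ℝ :=
  ((degIn G U u : ℝ) - 1) * x u - degIn G U u / 2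

section PathFree

variable {V : Type*} {G : SimpleGraph V} {U : Finset V}

theorem IsDiamond.closed (hP : PathFree G U) {a b c d : V} (h : IsDiamond G U a b c d)
    {u v : V} (hu : u = a ∨ u = b ∨ u = c ∨ u = d) (hv : v ∈ U) (huv : G.Adj u v) :
    v = a ∨ v = b ∨ v = c ∨ v = d := by
  by_contra! hne
  obtain ⟨ha, hb, hc, hd, hab, hac, hbc, hbd, hcd, had⟩ := h
  have h1 := hab.ne; have h2 := hac.ne; have h3 := hbc.ne; have h4 := hbd.ne; have h5 := hcd.ne
  obtain ⟨na, nb, nc, nd⟩ := hne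
  rcases hu with rfl | rfl | rfl | rfl
  · exact hP v hv u ha b hb c hc d hd huv.symm hab hbc hcd nb nc nd h2 had h4
  · exact hP v hv u hb a ha c hc d hd huv.symm hab.symm hac hcd na nc nd h3 h4 had
  · exact hP v hv u hc a ha b hb d hd huv.symm hac.symm hab hbd na nb nd h3.symm h5 had
  · exact hP v hv u hd b hb c hc a ha huv.symm hbd.symm hbc hac.symm nb nc na h5.symm had.symm h1.symm

/-- Outside diamonds, all but two neighbours of a vertex are leaves. -/
theorem card_nonleaf_le (hP : PathFree G U) {v : V} (hv : v ∈ U)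
    (hD : ∀ a b c, ¬ IsDiamond G U a v b c) :
    ((U.filter (G.Adj v)).filter (fun u => degIn G U u ≠ 1)).card ≤ 2 := by
  by_contra! hlt
  obtain ⟨a, ha, b, hb, c, hc, hab, hac, hbc⟩ := Finset.two_lt_card.mp hlt
  have key : ∀ u ∈ (U.filter (G.Adj v)).filter (fun u => degIn G U u ≠ 1),
      u ∈ U ∧ G.Adj v u ∧ ∃ u' ∈ U, u' ≠ v ∧ G.Adj u u' := by
    intro u hu
    simp only [Finset.mem_filter] at hu
    obtain ⟨⟨huU, huv⟩, hd⟩ := hu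
    refine ⟨huU, huv, ?_⟩
    by_contra! hno
    apply hd
    rw [degIn, Finset.card_eq_one]
    refine ⟨v, ?_⟩
    ext y
    simp only [Finset.mem_filter, Finset.mem_singleton]
    constructor
    · rintro ⟨hy, huy⟩
      by_contra hyv
      exact hno y hy hyv huy
    · rintro rfl
      exact ⟨hv, huv.symm⟩
  obtain ⟨haU, hva, a', ha'U, ha'v, haa'⟩ := key a ha
  obtain ⟨hbU, hvb, b', hb'U, hb'v, hbb'⟩ := key b hb
  obtain ⟨hcU, hvc, c', hc'U, hc'v, hcc'⟩ := key c hc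
  have hno : ∀ p q r r', p ∈ U → q ∈ U → r ∈ U → r' ∈ U → G.Adj v p → G.Adj v q → G.Adj v r →
      p ≠ q → p ≠ r → q ≠ r → r' ≠ v → G.Adj r r' → ¬ G.Adj p q := by
    intro p q r r' hp hq hr hr' hvp hvq hvr hpq hpr hqr hr'v hrr' hadj
    by_cases h1 : r' = p
    · subst h1
      exact hD q r' r ⟨hq, hv, hp, hr, hvq.symm, hadj.symm, hvp, hvr, hrr'.symm, hqr⟩
    by_cases h2 : r' = q
    · subst h2
      exact hD p r' r ⟨hp, hv, hq, hr, hvp.symm, hadj, hvq, hvr, hrr'.symm, hpr⟩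
    exact hP r' hr' r hr v hv p hp q hq hrr'.symm hvr.symm hvp hadj hr'v h1 h2 hpr.symm hqr.symm
      hvq.ne
  have nab := hno a b c c' haU hbU hcU hc'U hva hvb hvc hab hac hbc hc'v hcc'
  have nac := hno a c b b' haU hcU hbU hb'U hva hvc hvb hac hab hbc.symm hb'v hbb'
  have nbc := hno b c a a' hbU hcU haU ha'U hvb hvc hva hbc hab.symm hac.symm ha'v haa'
  have hsame : ∀ p q p' q', p ∈ U → q ∈ U → p' ∈ U → q' ∈ U → G.Adj v p → G.Adj v q → p ≠ q →
      p' ≠ v → q' ≠ v → G.Adj p p' → G.Adj q q' → ¬ G.Adj p q → p' = q' := by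
    intro p q p' q' hp hq hp' hq' hvp hvq hpq hp'v hq'v hpp' hqq' hnadj
    by_contra hne
    exact hP p' hp' p hp v hv q hq q' hq' hpp'.symm hvp.symm hvq hqq' hp'v
      (by rintro rfl; exact hnadj hpp') hne hpq (by rintro rfl; exact hnadj hqq'.symm) hq'v.symm
  have e1 := hsame a b a' b' haU hbU ha'U hb'U hva hvb hab ha'v hb'v haa' hbb' nab
  have e2 := hsame a c a' c' haU hcU ha'U hc'U hva hvc hac ha'v hc'v haa' hcc' nac
  subst e1 e2
  exact hP a haU v hv b hbU a' ha'U c hcU hva.symm hvb hbb' hcc'.symm hab haa'.ne hac ha'v.symm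
    hvc.ne hbc

/-- Degree count in a part of `U` without diamonds. -/
theorem sum_excess_nonpos (hP : PathFree G U) {x : V → ℝ} (hx0 : ∀ v, 0 ≤ x v)
    (hx1 : ∀ v, x v ≤ 1) {Y : Finset V} (hYU : Y ⊆ U)
    (hY : ∀ u ∈ Y, ∀ v ∈ U, G.Adj u v → v ∈ Y)
    (hD : ∀ v ∈ Y, ∀ a b c, ¬ IsDiamond G U a v b c) :
    ∑ u ∈ Y, excess G U x u ≤ 0 := by
  set leaf : V → Finset V := fun u => (U.filter (G.Adj u)).filter (fun v => degIn G U v = 1)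
    with hleaf
  have hpt : ∀ u ∈ Y, excess G U x u ≤
      (((leaf u).card : ℝ) - if degIn G U u = 1 then 1 else 0) / 2 := by
    intro u hu
    have h2 := card_nonleaf_le hP (hYU hu) (hD u hu)
    have hsplit := Finset.card_filter_add_card_filter_not (s := U.filter (G.Adj u))
      (fun v => degIn G U v = 1)
    have hle : degIn G U u ≤ (leaf u).card + 2 := by
      simp only [hleaf, degIn, ne_eq] at hsplit h2 ⊢
      omega
    have hle' : (degIn G U u : ℝ) ≤ (leaf u).card + 2 := by exact_mod_cast hle
    have := hx0 u
    have := hx1 u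
    have hnn : (0 : ℝ) ≤ (leaf u).card := Nat.cast_nonneg _
    unfold excess
    split_ifs with h1
    · rw [h1]; push_cast; linarith
    · rcases Nat.eq_zero_or_pos (degIn G U u) with h0 | h0
      · rw [h0]; push_cast; linarith
      · have : (1 : ℝ) ≤ degIn G U u := by exact_mod_cast h0
        nlinarith
  refine (Finset.sum_le_sum hpt).trans ?_
  rw [← Finset.sum_div, Finset.sum_sub_distrib, Finset.sum_boole]
  have hdisj : (Y : Set V).PairwiseDisjoint leaf := by
    intro u hu v hv huv
    rw [Function.onFun, Finset.disjoint_left]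
    intro y hy hy'
    simp only [hleaf, Finset.mem_filter] at hy hy'
    obtain ⟨z, hz⟩ := Finset.card_eq_one.mp hy.2
    have h1 : u ∈ U.filter (G.Adj y) := by simp [hYU hu, hy.1.2.symm]
    have h2 : v ∈ U.filter (G.Adj y) := by simp [hYU hv, hy'.1.2.symm]
    rw [hz, Finset.mem_singleton] at h1 h2
    exact huv (h1.trans h2.symm)
  have hcard : ∑ u ∈ Y, (leaf u).card ≤ (Y.filter (fun u => degIn G U u = 1)).card := by
    rw [← Finset.card_biUnion hdisj]
    apply Finset.card_le_card
    intro y hy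
    simp only [hleaf, Finset.mem_biUnion, Finset.mem_filter] at hy ⊢
    obtain ⟨u, hu, ⟨hyU, huy⟩, hd⟩ := hy
    exact ⟨hY u hu y hyU huy, hd⟩
  have : (∑ u ∈ Y, ((leaf u).card : ℝ)) ≤ (Y.filter (fun u => degIn G U u = 1)).card := by
    exact_mod_cast hcard
  linarith

/-- The vertex sets of diamonds contained in `X`. -/
noncomputable def diamonds (G : SimpleGraph V) (U X : Finset V) : Finset (Finset V) :=
  X.powerset.filter (fun K => ∃ a b c d, K = {a, b, c, d} ∧ IsDiamond G U a b c d)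

theorem mem_diamonds {X K : Finset V} : K ∈ diamonds G U X ↔
    K ⊆ X ∧ ∃ a b c d, K = {a, b, c, d} ∧ IsDiamond G U a b c d := by
  simp only [diamonds, Finset.mem_filter, Finset.mem_powerset]

theorem diamonds_closed (hP : PathFree G U) {X K : Finset V} (hK : K ∈ diamonds G U X) {u v : V}
    (hu : u ∈ K) (hv : v ∈ U) (huv : G.Adj u v) : v ∈ K := by
  obtain ⟨-, a, b, c, d, rfl, hd⟩ := mem_diamonds.mp hK
  simp only [Finset.mem_insert, Finset.mem_singleton] at hu ⊢
  exact hd.closed hP hu hv huv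

theorem diamonds_subset (hP : PathFree G U) {X K L : Finset V} (hK : K ∈ diamonds G U X)
    (hL : L ∈ diamonds G U X) {u : V} (huK : u ∈ K) (huL : u ∈ L) : K ⊆ L := by
  obtain ⟨-, a, b, c, d, rfl, h⟩ := mem_diamonds.mp hK
  have cl := fun u v => diamonds_closed hP hL (u := u) (v := v)
  have : a ∈ L := by
    simp only [Finset.mem_insert, Finset.mem_singleton] at huK
    rcases huK with rfl | rfl | rfl | rfl
    · exact huL
    · exact cl _ _ huL h.ha h.hab.symm
    · exact cl _ _ huL h.ha h.hac.symm
    · exact cl _ _ (cl _ _ huL h.hb h.hbd.symm) h.ha h.hab.symm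
  have hb := cl _ _ this h.hb h.hab
  intro y hy
  simp only [Finset.mem_insert, Finset.mem_singleton] at hy
  rcases hy with rfl | rfl | rfl | rfl
  · exact this
  · exact hb
  · exact cl _ _ this h.hc h.hac
  · exact cl _ _ hb h.hd h.hbd

theorem diamonds_pairwiseDisjoint (hP : PathFree G U) {X : Finset V} :
    (diamonds G U X : Set (Finset V)).PairwiseDisjoint id := by
  intro K hK L hL hne
  rw [Function.onFun, Finset.disjoint_left]
  intro u huK huL
  exact hne ((diamonds_subset hP hK hL huK huL).antisymm (diamonds_subset hP hL hK huL huK))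

/-- Only diamonds contribute positively. -/
theorem sum_excess_le (hP : PathFree G U) {x : V → ℝ} (hx0 : ∀ v, 0 ≤ x v)
    (hx1 : ∀ v, x v ≤ 1) {X : Finset V} (hXU : X ⊆ U)
    (hX : ∀ u ∈ X, ∀ v ∈ U, G.Adj u v → v ∈ X) :
    ∑ u ∈ X, excess G U x u ≤ ∑ K ∈ diamonds G U X, ∑ u ∈ K, excess G U x u := by
  set B := (diamonds G U X).biUnion id with hB
  have hBX : B ⊆ X := by
    intro u hu
    obtain ⟨K, hK, huK⟩ := Finset.mem_biUnion.mp hu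
    exact (mem_diamonds.mp hK).1 huK
  have h1 : ∑ u ∈ B, excess G U x u = ∑ K ∈ diamonds G U X, ∑ u ∈ K, excess G U x u :=
    Finset.sum_biUnion (diamonds_pairwiseDisjoint hP)
  have h2 : ∑ u ∈ X \ B, excess G U x u ≤ 0 := by
    apply sum_excess_nonpos hP hx0 hx1 (Finset.sdiff_subset.trans hXU)
    · intro u hu v hv huv
      rw [Finset.mem_sdiff] at hu ⊢
      refine ⟨hX u hu.1 v hv huv, fun hvB => hu.2 ?_⟩
      obtain ⟨K, hK, hvK⟩ := Finset.mem_biUnion.mp hvB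
      exact Finset.mem_biUnion.mpr ⟨K, hK, diamonds_closed hP hK hvK (hXU hu.1) huv.symm⟩
    · intro v hv a c d h
      rw [Finset.mem_sdiff] at hv
      have ha := hX v hv.1 a h.ha h.hab.symm
      refine hv.2 (Finset.mem_biUnion.mpr ⟨{a, v, c, d}, mem_diamonds.mpr ⟨?_, a, v, c, d,
        rfl, h⟩, by simp⟩)
      intro y hy
      simp only [Finset.mem_insert, Finset.mem_singleton] at hy
      rcases hy with rfl | rfl | rfl | rfl
      · exact ha
      · exact hv.1
      · exact hX _ hv.1 _ h.hc h.hbc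
      · exact hX _ hv.1 _ h.hd h.hbd
  rw [← Finset.sum_sdiff hBX, h1]
  linarith

end PathFree

/-- The entries of the adjacency matrix. -/
noncomputable def ind {V : Type*} (G : SimpleGraph V) (u v : V) : ℝ := if G.Adj u v then 1 else 0

theorem ind_comm {V : Type*} (G : SimpleGraph V) (u v : V) : ind G u v = ind G v u := by
  simp only [ind, G.adj_comm]

theorem ind_nonneg {V : Type*} (G : SimpleGraph V) (u v : V) : 0 ≤ ind G u v := by
  unfold ind; split_ifs <;> norm_num

theorem ind_le_one {V : Type*} (G : SimpleGraph V) (u v : V) : ind G u v ≤ 1 := by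
  unfold ind; split_ifs <;> norm_num

theorem ind_eq_one {V : Type*} {G : SimpleGraph V} {u v : V} (h : G.Adj u v) : ind G u v = 1 :=
  if_pos h

theorem ind_eq_zero {V : Type*} {G : SimpleGraph V} {u v : V} (h : ¬ G.Adj u v) : ind G u v = 0 :=
  if_neg h

theorem sum_ind_mul {V : Type*} (G : SimpleGraph V) (U : Finset V) (x : V → ℝ) (u : V) :
    ∑ v ∈ U, ind G u v * x v = ∑ v ∈ U.filter (G.Adj u), x v := by
  simp only [ind, ite_mul, one_mul, zero_mul, Finset.sum_filter]

theorem degIn_eq_sum {V : Type*} (G : SimpleGraph V) (U : Finset V) (u : V) :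
    (degIn G U u : ℝ) = ∑ v ∈ U, ind G u v := by
  simp only [ind, Finset.sum_boole, degIn]

/-- The neighbours of `h`. -/
noncomputable def near {V : Type*} [Fintype V] (G : SimpleGraph V) (h : V) : Finset V :=
  Finset.univ.filter (G.Adj h)

/-- The vertices at distance at least two from `h`. -/
noncomputable def far {V : Type*} [Fintype V] (G : SimpleGraph V) (h : V) : Finset V :=
  Finset.univ.filter (fun v => v ≠ h ∧ ¬ G.Adj h v)

theorem mem_near {V : Type*} [Fintype V] {G : SimpleGraph V} {h v : V} :
    v ∈ near G h ↔ G.Adj h v := by simp [near]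

theorem mem_far {V : Type*} [Fintype V] {G : SimpleGraph V} {h v : V} :
    v ∈ far G h ↔ v ≠ h ∧ ¬ G.Adj h v := by simp [far]

/-- A fan-free graph with large spectral radius `lam`, whose eigenvector `x` is scaled to have
maximum value `1`, attained at `h`. -/
structure FanFreeEigen {V : Type*} [Fintype V] (G : SimpleGraph V) (h : V) (x : V → ℝ)
    (lam : ℝ) : Prop where
  free : F6Free G
  pos : ∀ v, 0 < x v
  le_one : ∀ v, x v ≤ 1
  hub : x h = 1
  eig : ∀ u, ∑ v, ind G u v * x v = lam * x u
  lam_ge : 9.8 ≤ lam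
  edges : ∑ v, ∑ w, ind G v w ≤ 2 * (lam ^ 2 - lam + 1)

namespace FanFreeEigen

variable {V : Type*} [Fintype V] {G : SimpleGraph V} {h : V} {x : V → ℝ} {lam : ℝ}

theorem sum_split (G : SimpleGraph V) (h : V) (g : V → ℝ) :
    ∑ v, g v = g h + ∑ v ∈ near G h, g v + ∑ v ∈ far G h, g v := by
  have h1 := Finset.sum_filter_add_sum_filter_not Finset.univ (fun v => v = h) g
  have h2 := Finset.sum_filter_add_sum_filter_not (Finset.univ.filter (fun v => ¬ v = h))
    (fun v => G.Adj h v) g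
  have h0 : Finset.univ.filter (fun v => v = h) = {h} := by ext; simp
  rw [h0, Finset.sum_singleton] at h1
  rw [Finset.filter_filter, Finset.filter_filter] at h2
  have h3 : Finset.univ.filter (fun v => ¬ v = h ∧ G.Adj h v) = near G h := by
    ext v
    simp only [near, Finset.mem_filter, Finset.mem_univ, true_and, and_iff_right_iff_imp]
    exact fun hv => hv.ne'
  rw [h3] at h2
  rw [← h1, ← h2]
  simp only [far, ne_eq]
  ring

theorem pathFree (S : FanFreeEigen G h x lam) : PathFree G (near G h) := by
  intro p hp q hq r hr s hs t ht
  rw [mem_near] at hp hq hr hs ht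
  exact fun h1 h2 h3 h4 => S.free.no_path hp hq hr hs ht h1 h2 h3 h4

theorem eig_near (S : FanFreeEigen G h x lam) {u : V} (hu : u ∈ near G h) :
    lam * x u = 1 + ∑ v ∈ near G h, ind G u v * x v + ∑ v ∈ far G h, ind G u v * x v := by
  rw [← S.eig u, sum_split G h, S.hub, ind_eq_one (mem_near.mp hu).symm, mul_one]

/-- The neighbours of `h` have total weight `lam`. -/
theorem sum_near (S : FanFreeEigen G h x lam) : lam = ∑ u ∈ near G h, x u := by
  have := S.eig h
  rw [sum_split G h, S.hub, ind_eq_zero (G.loopless.irrefl h)] at this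
  have h2 : ∑ v ∈ near G h, ind G h v * x v = ∑ v ∈ near G h, x v :=
    Finset.sum_congr rfl fun v hv => by rw [ind_eq_one (mem_near.mp hv), one_mul]
  have h3 : ∑ v ∈ far G h, ind G h v * x v = 0 :=
    Finset.sum_eq_zero fun v hv => by rw [ind_eq_zero (mem_far.mp hv).2, zero_mul]
  linarith

/-- A vertex missing part of the neighbourhood of `h` has a small entry. -/
theorem missing_le (S : FanFreeEigen G h x lam) {w : V} (hw : w ∈ far G h) :
    ∑ u ∈ near G h, (1 - ind G u w) * x u ≤
      lam * (1 - x w) + ∑ v ∈ far G h, ind G w v := by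
  have h1 := S.sum_near
  have h2 := S.eig w
  rw [sum_split G h, ind_comm, ind_eq_zero (mem_far.mp hw).2] at h2
  have h3 : ∑ v ∈ far G h, ind G w v * x v ≤ ∑ v ∈ far G h, ind G w v :=
    Finset.sum_le_sum fun v _ => mul_le_of_le_one_right (ind_nonneg G w v) (S.le_one v)
  have h4 : ∑ u ∈ near G h, (1 - ind G u w) * x u =
      ∑ u ∈ near G h, x u - ∑ u ∈ near G h, ind G w u * x u := by
    rw [← Finset.sum_sub_distrib]
    exact Finset.sum_congr rfl fun u _ => by rw [ind_comm]; ring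
  rw [h4]
  linarith

/-- Counting the edges against the second power of the adjacency matrix. -/
theorem deficit_le (S : FanFreeEigen G h x lam) :
    ∑ w ∈ far G h, (∑ u ∈ near G h, ind G u w) * (1 - x w) +
      (∑ w ∈ far G h, ∑ v ∈ far G h, ind G w v) / 2 ≤
      1 + ∑ u ∈ near G h, excess G (near G h) x u := by
  have hlam := S.sum_near
  have hsq : lam ^ 2 = (near G h).card +
      ∑ v ∈ near G h, (∑ u ∈ near G h, ind G v u) * x v +
      ∑ v ∈ far G h, (∑ u ∈ near G h, ind G u v) * x v := by
    have h1 : lam ^ 2 = ∑ u ∈ near G h, lam * x u := by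
      rw [← Finset.mul_sum, ← hlam, sq]
    rw [h1, Finset.sum_congr rfl fun u hu => S.eig_near hu, Finset.sum_add_distrib,
      Finset.sum_add_distrib, Finset.sum_const, nsmul_eq_mul, mul_one,
      Finset.sum_comm (s := near G h) (t := near G h),
      Finset.sum_comm (s := near G h) (t := far G h)]
    simp only [← Finset.sum_mul]
    congr 2
    exact Finset.sum_congr rfl fun v _ => by simp only [ind_comm G v]
  have hE := S.edges
  rw [sum_split G h] at hE
  have e1 : ∑ w, ind G h w = (near G h).card := by
    simp only [ind, Finset.sum_boole, near]
  have e2 : ∑ v ∈ near G h, ∑ w, ind G v w = (near G h).card +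
      ∑ v ∈ near G h, ∑ u ∈ near G h, ind G v u +
      ∑ v ∈ near G h, ∑ u ∈ far G h, ind G v u := by
    have : ∀ v ∈ near G h, ∑ w, ind G v w = 1 + ∑ u ∈ near G h, ind G v u +
        ∑ u ∈ far G h, ind G v u := fun v hv => by
      rw [sum_split G h, ind_eq_one (mem_near.mp hv).symm]
    rw [Finset.sum_congr rfl this, Finset.sum_add_distrib, Finset.sum_add_distrib]
    simp
  have e3 : ∑ v ∈ far G h, ∑ w, ind G v w =
      ∑ v ∈ far G h, ∑ u ∈ near G h, ind G u v +
      ∑ v ∈ far G h, ∑ u ∈ far G h, ind G v u := by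
    rw [← Finset.sum_add_distrib]
    refine Finset.sum_congr rfl fun v hv => ?_
    rw [sum_split G h, ind_comm, ind_eq_zero (mem_far.mp hv).2, zero_add]
    simp only [ind_comm G v]
  rw [e1, e2, e3, Finset.sum_comm (s := near G h) (t := far G h)] at hE
  have e4 : ∑ u ∈ near G h, excess G (near G h) x u =
      ∑ v ∈ near G h, (∑ u ∈ near G h, ind G v u) * x v - lam -
      (∑ v ∈ near G h, ∑ u ∈ near G h, ind G v u) / 2 := by
    rw [hlam, Finset.sum_div, ← Finset.sum_sub_distrib, ← Finset.sum_sub_distrib]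
    refine Finset.sum_congr rfl fun v _ => ?_
    rw [excess, degIn_eq_sum]
    ring
  have e5 : ∑ w ∈ far G h, (∑ u ∈ near G h, ind G u w) * (1 - x w) =
      ∑ w ∈ far G h, (∑ u ∈ near G h, ind G u w) -
      ∑ w ∈ far G h, (∑ u ∈ near G h, ind G u w) * x w := by
    rw [← Finset.sum_sub_distrib]
    exact Finset.sum_congr rfl fun v _ => by ring
  rw [e4, e5]
  linarith

/-- For a small set `Q` of neighbours of `h`, the vertices adjacent to `Q` cannot miss much of the
neighbourhood of `h`. -/
theorem budget (S : FanFreeEigen G h x lam) {Q : Finset V} (hQ : Q ⊆ near G h)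
    (hcard : Q.card ≤ 4) :
    ∑ w ∈ far G h, (∑ q ∈ Q, ind G q w) * (∑ u ∈ near G h, (1 - ind G u w) * x u) ≤
      lam * (1 + ∑ u ∈ near G h, excess G (near G h) x u) := by
  have hl := S.lam_ge
  have h1 := S.deficit_le
  have h2 : ∀ w ∈ far G h,
      (∑ q ∈ Q, ind G q w) * (∑ u ∈ near G h, (1 - ind G u w) * x u) ≤
      lam * ((∑ u ∈ near G h, ind G u w) * (1 - x w)) + 4 * ∑ v ∈ far G h, ind G w v := by
    intro w hw
    have q0 : 0 ≤ ∑ q ∈ Q, ind G q w := Finset.sum_nonneg fun q _ => ind_nonneg G q w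
    have qD : ∑ q ∈ Q, ind G q w ≤ ∑ u ∈ near G h, ind G u w :=
      Finset.sum_le_sum_of_subset_of_nonneg hQ fun q _ _ => ind_nonneg G q w
    have q4 : ∑ q ∈ Q, ind G q w ≤ 4 := by
      calc ∑ q ∈ Q, ind G q w ≤ ∑ q ∈ Q, (1 : ℝ) := Finset.sum_le_sum fun q _ => ind_le_one G q w
        _ ≤ 4 := by simpa using (by exact_mod_cast hcard : (Q.card : ℝ) ≤ 4)
    have hE : 0 ≤ ∑ v ∈ far G h, ind G w v := Finset.sum_nonneg fun v _ => ind_nonneg G w v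
    have hx : 0 ≤ 1 - x w := by linarith [S.le_one w]
    calc _ ≤ (∑ q ∈ Q, ind G q w) * (lam * (1 - x w) + ∑ v ∈ far G h, ind G w v) :=
          mul_le_mul_of_nonneg_left (S.missing_le hw) q0
      _ = lam * ((∑ q ∈ Q, ind G q w) * (1 - x w)) +
          (∑ q ∈ Q, ind G q w) * ∑ v ∈ far G h, ind G w v := by ring
      _ ≤ _ := by gcongr
  have h3 := Finset.sum_le_sum h2
  rw [Finset.sum_add_distrib, ← Finset.mul_sum, ← Finset.mul_sum] at h3
  have hE : 0 ≤ ∑ w ∈ far G h, ∑ v ∈ far G h, ind G w v :=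
    Finset.sum_nonneg fun w _ => Finset.sum_nonneg fun v _ => ind_nonneg G w v
  nlinarith

/-- The eigenvalue equation forces many edges from `Q` to the vertices far from `h`. -/
theorem le_cut (S : FanFreeEigen G h x lam) {Q : Finset V} (hQ : Q ⊆ near G h) :
    ∑ q ∈ Q, (lam * x q - 1 - ∑ v ∈ (near G h).filter (G.Adj q), x v) ≤
      ∑ w ∈ far G h, ∑ q ∈ Q, ind G q w := by
  rw [Finset.sum_comm]
  refine Finset.sum_le_sum fun q hq => ?_
  have := S.eig_near (hQ hq)
  rw [sum_ind_mul] at this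
  have h3 : ∑ v ∈ far G h, ind G q v * x v ≤ ∑ v ∈ far G h, ind G q v :=
    Finset.sum_le_sum fun v _ => mul_le_of_le_one_right (ind_nonneg G q v) (S.le_one v)
  linarith

theorem diamond_filter (S : FanFreeEigen G h x lam) {a b c d : V}
    (hd : IsDiamond G (near G h) a b c d) :
    (near G h).filter (G.Adj b) = {a, c, d} ∧ (near G h).filter (G.Adj c) = {a, b, d} ∧
    (near G h).filter (G.Adj a) = (if G.Adj a d then {b, c, d} else {b, c}) ∧
    (near G h).filter (G.Adj d) = (if G.Adj a d then {a, b, c} else {b, c}) := by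
  have cl := fun u v => hd.closed S.pathFree (u := u) (v := v)
  obtain ⟨ha, hb, hc, hd, hab, hac, hbc, hbd, hcd, had⟩ := hd
  refine ⟨?_, ?_, ?_, ?_⟩
  · ext v
    simp only [Finset.mem_filter, Finset.mem_insert, Finset.mem_singleton]
    constructor
    · rintro ⟨hv, h1⟩
      have := cl b v (by simp) hv h1
      have := h1.ne'
      tauto
    · rintro (rfl | rfl | rfl)
      exacts [⟨ha, hab.symm⟩, ⟨hc, hbc⟩, ⟨hd, hbd⟩]
  · ext v
    simp only [Finset.mem_filter, Finset.mem_insert, Finset.mem_singleton]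
    constructor
    · rintro ⟨hv, h1⟩
      have := cl c v (by simp) hv h1
      have := h1.ne'
      tauto
    · rintro (rfl | rfl | rfl)
      exacts [⟨ha, hac.symm⟩, ⟨hb, hbc.symm⟩, ⟨hd, hcd⟩]
  · ext v
    have h2 := cl a v (by simp)
    split_ifs with had' <;>
    · simp only [Finset.mem_filter, Finset.mem_insert, Finset.mem_singleton]
      constructor
      · rintro ⟨hv, h1⟩
        have := h2 hv h1
        have := h1.ne'
        grind
      · grind
  · ext v
    have h2 := cl d v (by simp)
    split_ifs with had' <;>
    · simp only [Finset.mem_filter, Finset.mem_insert, Finset.mem_singleton]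
      constructor
      · rintro ⟨hv, h1⟩
        have := h2 hv h1
        have := h1.ne'
        have := h1.symm
        grind
      · have := had.symm
        have := hbd.symm
        have := hcd.symm
        have := fun h => G.adj_symm (u := a) (v := d) h
        grind

/-- A diamond contributing positively is mostly missed by each far vertex, but has many edges to
the far vertices. -/
theorem diamond_positive (S : FanFreeEigen G h x lam) {K : Finset V}
    (hK : K ∈ diamonds G (near G h) (near G h))
    (hpos : 0 < ∑ u ∈ K, excess G (near G h) x u) :
    (∀ w ∈ far G h, max (∑ u ∈ K, excess G (near G h) x u) (3 / 2) ≤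
      ∑ u ∈ K, (1 - ind G u w) * x u) ∧
    3 * lam - 13 ≤ ∑ q ∈ K, (lam * x q - 1 - ∑ v ∈ (near G h).filter (G.Adj q), x v) := by
  obtain ⟨-, a, b, c, d, rfl, hd⟩ := mem_diamonds.mp hK
  obtain ⟨fb, fc, fa, fd⟩ := S.diamond_filter hd
  obtain ⟨ha, hb, hc, hd, hab, hac, hbc, hbd, hcd, had⟩ := hd
  have nab := hab.ne; have nac := hac.ne; have nbc := hbc.ne; have nbd := hbd.ne
  have ncd := hcd.ne
  have hl := S.lam_ge
  have a0 := S.pos a; have b0 := S.pos b; have c0 := S.pos c; have d0 := S.pos d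
  have a1 := S.le_one a; have b1 := S.le_one b; have c1 := S.le_one c; have d1 := S.le_one d
  have sum4 : ∀ g : V → ℝ, ∑ u ∈ ({a, b, c, d} : Finset V), g u = g a + g b + g c + g d := by
    intro g
    rw [Finset.sum_insert (by simp [nab, nac, had]), Finset.sum_insert (by simp [nbc, nbd]),
      Finset.sum_insert (by simp [ncd]), Finset.sum_singleton]
    ring
  have sb : ∑ v ∈ ({a, c, d} : Finset V), x v = x a + x c + x d := by
    rw [Finset.sum_insert (by simp [nac, had]), Finset.sum_insert (by simp [ncd]),
      Finset.sum_singleton]; ring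
  have sc : ∑ v ∈ ({a, b, d} : Finset V), x v = x a + x b + x d := by
    rw [Finset.sum_insert (by simp [nab, had]), Finset.sum_insert (by simp [nbd]),
      Finset.sum_singleton]; ring
  have db : degIn G (near G h) b = 3 := by
    rw [degIn, fb, Finset.card_eq_three]; exact ⟨a, c, d, nac, had, ncd, rfl⟩
  have dc : degIn G (near G h) c = 3 := by
    rw [degIn, fc, Finset.card_eq_three]; exact ⟨a, b, d, nab, had, nbd, rfl⟩
  rw [sum4] at hpos
  simp only [sum4]
  rw [fa, fb, fc, fd, sb, sc]
  rw [mem_near] at ha hb hc hd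
  have wab : ∀ w, w ≠ h → ¬ G.Adj h w → G.Adj a w → ¬ G.Adj b w := fun w w1 w2 haw hbw =>
    S.free.no_path hbw hab.symm hbc hbd hb.symm haw.symm hac hcd hd.symm
      (by rintro rfl; exact w2 hc) (by rintro rfl; exact w2 hd) w1 had ha.ne' hc.ne'
  have wac : ∀ w, w ≠ h → ¬ G.Adj h w → G.Adj a w → ¬ G.Adj c w := fun w w1 w2 haw hcw =>
    S.free.no_path hcw hac.symm hbc.symm hcd hc.symm haw.symm hab hbd hd.symm
      (by rintro rfl; exact w2 hb) (by rintro rfl; exact w2 hd) w1 had ha.ne' hb.ne'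
  have wdb : ∀ w, w ≠ h → ¬ G.Adj h w → G.Adj d w → ¬ G.Adj b w := fun w w1 w2 hdw hbw =>
    S.free.no_path hbw hbd hbc hab.symm hb.symm hdw.symm hcd.symm hac.symm ha.symm
      (by rintro rfl; exact w2 hc) (by rintro rfl; exact w2 ha) w1 had.symm hd.ne' hc.ne'
  have wdc : ∀ w, w ≠ h → ¬ G.Adj h w → G.Adj d w → ¬ G.Adj c w := fun w w1 w2 hdw hcw =>
    S.free.no_path hcw hcd hbc.symm hac.symm hc.symm hdw.symm hbd.symm hab.symm ha.symm
      (by rintro rfl; exact w2 hb) (by rintro rfl; exact w2 ha) w1 had.symm hd.ne' hb.ne'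
  have wbc : ∀ w, w ≠ h → ¬ G.Adj h w → G.Adj b w → ¬ G.Adj c w := fun w w1 w2 hbw hcw =>
    S.free.no_path hbw hbc hab.symm hb.symm hbd hcw.symm hac.symm ha.symm hd
      (by rintro rfl; exact w2 ha) w1 (by rintro rfl; exact w2 hd) hc.ne' ncd had
  have wad : G.Adj a d → ∀ w, w ≠ h → ¬ G.Adj h w → G.Adj a w → ¬ G.Adj d w :=
    fun had' w w1 w2 haw hdw =>
    S.free.no_path haw had' hab ha.symm hac hdw.symm hbd.symm hb.symm hc
      (by rintro rfl; exact w2 hb) w1 (by rintro rfl; exact w2 hc) hd.ne' ncd.symm nbc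
  simp only [excess, db, dc, Nat.cast_ofNat] at hpos ⊢
  by_cases had' : G.Adj a d
  · rw [if_pos had'] at fa fd
    have da : degIn G (near G h) a = 3 := by
      rw [degIn, fa, Finset.card_eq_three]; exact ⟨b, c, d, nbc, nbd, ncd, rfl⟩
    have dd : degIn G (near G h) d = 3 := by
      rw [degIn, fd, Finset.card_eq_three]; exact ⟨a, b, c, nab, nac, nbc, rfl⟩
    have sa : ∑ v ∈ ({b, c, d} : Finset V), x v = x b + x c + x d := by
      rw [Finset.sum_insert (by simp [nbc, nbd]), Finset.sum_insert (by simp [ncd]),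
        Finset.sum_singleton]; ring
    have sd : ∑ v ∈ ({a, b, c} : Finset V), x v = x a + x b + x c := by
      rw [Finset.sum_insert (by simp [nab, nac]), Finset.sum_insert (by simp [nbc]),
        Finset.sum_singleton]; ring
    rw [if_pos had', if_pos had', sa, sd]
    simp only [da, dd, Nat.cast_ofNat] at hpos ⊢
    constructor
    · intro w hw
      obtain ⟨w1, w2⟩ := mem_far.mp hw
      rw [max_le_iff]
      by_cases kb : G.Adj b w
      · rw [ind_eq_one kb, ind_eq_zero fun k => wab w w1 w2 k kb, ind_eq_zero (wbc w w1 w2 kb),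
          ind_eq_zero fun k => wdb w w1 w2 k kb]
        constructor <;> linarith
      by_cases kc : G.Adj c w
      · rw [ind_eq_zero kb, ind_eq_one kc, ind_eq_zero fun k => wac w w1 w2 k kc,
          ind_eq_zero fun k => wdc w w1 w2 k kc]
        constructor <;> linarith
      rw [ind_eq_zero kb, ind_eq_zero kc]
      by_cases ka : G.Adj a w
      · rw [ind_eq_one ka, ind_eq_zero (wad had' w w1 w2 ka)]
        constructor <;> linarith
      · rw [ind_eq_zero ka]
        constructor <;> linarith [mul_nonneg (sub_nonneg.mpr (ind_le_one G d w)) d0.le]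
    · have hS : 3 ≤ x a + x b + x c + x d := by linarith
      linarith [mul_nonneg (sub_nonneg.mpr hS) (sub_nonneg.mpr hl)]
  · rw [if_neg had'] at fa fd
    have da : degIn G (near G h) a = 2 := by rw [degIn, fa, Finset.card_pair nbc]
    have dd : degIn G (near G h) d = 2 := by rw [degIn, fd, Finset.card_pair nbc]
    rw [if_neg had', if_neg had', Finset.sum_pair nbc]
    simp only [da, dd, Nat.cast_ofNat] at hpos ⊢
    constructor
    · intro w hw
      obtain ⟨w1, w2⟩ := mem_far.mp hw
      rw [max_le_iff]
      by_cases kb : G.Adj b w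
      · rw [ind_eq_one kb, ind_eq_zero fun k => wab w w1 w2 k kb, ind_eq_zero (wbc w w1 w2 kb),
          ind_eq_zero fun k => wdb w w1 w2 k kb]
        constructor <;> linarith
      by_cases kc : G.Adj c w
      · rw [ind_eq_zero kb, ind_eq_one kc, ind_eq_zero fun k => wac w w1 w2 k kc,
          ind_eq_zero fun k => wdc w w1 w2 k kc]
        constructor <;> linarith
      rw [ind_eq_zero kb, ind_eq_zero kc]
      by_cases ka : G.Adj a w
      · rw [ind_eq_one ka]
        constructor <;> linarith [mul_nonneg (sub_nonneg.mpr (ind_le_one G d w)) d0.le]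
      · rw [ind_eq_zero ka]
        constructor <;> linarith [mul_nonneg (sub_nonneg.mpr (ind_le_one G d w)) d0.le]
    · have hS : 3 ≤ x a + x b + x c + x d := by linarith
      linarith [mul_nonneg (sub_nonneg.mpr hS) (sub_nonneg.mpr hl)]

/-- No diamond in the neighbourhood of `h` contributes positively. -/
theorem diamond_nonpos (S : FanFreeEigen G h x lam) {K : Finset V}
    (hK : K ∈ diamonds G (near G h) (near G h)) :
    ∑ u ∈ K, excess G (near G h) x u ≤ 0 := by
  by_contra! hpos
  have hl := S.lam_ge
  set U := near G h with hU
  set P := (diamonds G U U).filter (fun L => 0 < ∑ u ∈ L, excess G U x u) with hP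
  set μ : Finset V → ℝ := fun L => max (∑ u ∈ L, excess G U x u) (3 / 2) with hμ
  have hKU : K ⊆ U := (mem_diamonds.mp hK).1
  have hK4 : K.card ≤ 4 := by
    obtain ⟨-, a, b, c, d, rfl, hd⟩ := mem_diamonds.mp hK
    exact Finset.card_le_four
  have hKP : K ∈ P := Finset.mem_filter.mpr ⟨hK, hpos⟩
  have hμ0 : ∀ L, 0 ≤ μ L := fun L => le_trans (by norm_num) (le_max_right _ _)
  have hM : 3 / 2 ≤ ∑ L ∈ P, μ L :=
    (le_max_right _ _).trans (Finset.single_le_sum (f := μ) (fun L _ => hμ0 L) hKP)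
  have hexc : ∑ u ∈ U, excess G U x u ≤ ∑ L ∈ P, μ L := by
    refine (sum_excess_le S.pathFree (fun v => (S.pos v).le) S.le_one subset_rfl
      fun _ _ v hv _ => hv).trans ?_
    rw [hP, Finset.sum_filter]
    refine Finset.sum_le_sum fun L _ => ?_
    split_ifs with h1
    · exact le_max_left _ _
    · exact not_lt.mp h1
  have hmiss : ∀ w ∈ far G h, ∑ L ∈ P, μ L ≤ ∑ u ∈ U, (1 - ind G u w) * x u := by
    intro w hw
    have hnn : ∀ u, 0 ≤ (1 - ind G u w) * x u := fun u =>
      mul_nonneg (by linarith [ind_le_one G u w]) (S.pos u).le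
    have hdisj : (P : Set (Finset V)).PairwiseDisjoint id :=
      (diamonds_pairwiseDisjoint (X := U) S.pathFree).subset
        (fun L hL => (Finset.mem_filter.mp hL).1)
    calc ∑ L ∈ P, μ L ≤ ∑ L ∈ P, ∑ u ∈ L, (1 - ind G u w) * x u :=
          Finset.sum_le_sum fun L hL =>
            (S.diamond_positive (Finset.mem_filter.mp hL).1 (Finset.mem_filter.mp hL).2).1 w hw
      _ = ∑ u ∈ P.biUnion id, (1 - ind G u w) * x u := (Finset.sum_biUnion hdisj).symm
      _ ≤ _ := by
          refine Finset.sum_le_sum_of_subset_of_nonneg ?_ fun u _ _ => hnn u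
          intro u hu
          obtain ⟨L, hL, huL⟩ := Finset.mem_biUnion.mp hu
          exact (mem_diamonds.mp (Finset.mem_filter.mp hL).1).1 huL
  have hcut := (S.diamond_positive hK hpos).2.trans (S.le_cut hKU)
  have hb := S.budget hKU hK4
  have hlow : (∑ L ∈ P, μ L) * (∑ w ∈ far G h, ∑ q ∈ K, ind G q w) ≤
      ∑ w ∈ far G h, (∑ q ∈ K, ind G q w) * (∑ u ∈ U, (1 - ind G u w) * x u) := by
    rw [Finset.mul_sum]
    refine Finset.sum_le_sum fun w hw => ?_
    rw [mul_comm]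
    exact mul_le_mul_of_nonneg_left (hmiss w hw) (Finset.sum_nonneg fun q _ => ind_nonneg G q w)
  set M := ∑ L ∈ P, μ L
  have h1 : M * (3 * lam - 13) ≤ lam * (1 + M) :=
    (mul_le_mul_of_nonneg_left hcut (by linarith)).trans (hlow.trans (hb.trans
      (mul_le_mul_of_nonneg_left (by linarith) (by linarith))))
  nlinarith

/-- A triangle with pendant edges at `c`, attached to nothing else in the neighbourhood of `h`,
cannot occur. -/
theorem no_starPlusEdge (S : FanFreeEigen G h x lam) {a b c : V} (ha : G.Adj h a)
    (hb : G.Adj h b) (hc : G.Adj h c) (hab : G.Adj a b) (hca : G.Adj c a) (hcb : G.Adj c b)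
    (fa : (near G h).filter (G.Adj a) = {b, c}) (fb : (near G h).filter (G.Adj b) = {a, c})
    (fl : ∀ v ∈ (near G h).filter (G.Adj c), v ≠ a → v ≠ b →
      (near G h).filter (G.Adj v) = {c}) : False := by
  have hl := S.lam_ge
  have a0 := S.pos a; have b0 := S.pos b; have c0 := S.pos c
  have a1 := S.le_one a; have b1 := S.le_one b; have c1 := S.le_one c
  have nab := hab.ne; have nca := hca.ne; have ncb := hcb.ne
  set U := near G h with hU
  have hmU : ∀ v, v ∈ U ↔ G.Adj h v := fun v => mem_near
  set N := U.filter (G.Adj c) with hN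
  have haN : a ∈ N := Finset.mem_filter.mpr ⟨(hmU a).mpr ha, hca⟩
  have hbN : b ∈ N := Finset.mem_filter.mpr ⟨(hmU b).mpr hb, hcb⟩
  set L := N \ {a, b} with hL
  have habN : ({a, b} : Finset V) ⊆ N := by
    intro v hv
    simp only [Finset.mem_insert, Finset.mem_singleton] at hv
    rcases hv with rfl | rfl <;> assumption
  have hcN : c ∉ N := by simp [hN]
  have hNL : (N.card : ℝ) = L.card + 2 := by
    rw [hL, ← Finset.card_sdiff_add_card_eq_card habN, Finset.card_pair nab]
    push_cast; rfl
  have hCU : insert c N ⊆ U :=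
    Finset.insert_subset ((hmU c).mpr hc) (Finset.filter_subset _ _)
  have hexL : ∑ u ∈ L, excess G U x u = L.card * (-1 / 2) := by
    rw [Finset.sum_congr rfl (g := fun _ => (-1 / 2 : ℝ)), Finset.sum_const, nsmul_eq_mul]
    intro u hu
    simp only [hL, Finset.mem_sdiff, Finset.mem_insert, Finset.mem_singleton, not_or] at hu
    rw [excess, degIn, fl u hu.1 hu.2.1 hu.2.2, Finset.card_singleton]
    push_cast; ring
  have hexC : ∑ u ∈ insert c N, excess G U x u =
      (L.card + 1) * x c + x a + x b - L.card - 3 := by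
    rw [Finset.sum_insert hcN, ← Finset.sum_sdiff habN, hexL, Finset.sum_pair nab]
    simp only [excess]
    have da : degIn G U a = 2 := by rw [degIn, fa, Finset.card_pair ncb.symm]
    have db : degIn G U b = 2 := by rw [degIn, fb, Finset.card_pair nca.symm]
    have dc : (degIn G U c : ℝ) = L.card + 2 := by rw [← hNL, degIn]
    rw [da, db, dc]
    push_cast; ring
  have hclosed : ∀ u ∈ insert c N, ∀ v ∈ U, G.Adj u v → v ∈ insert c N := by
    intro u hu v hv huv
    have hvf : v ∈ U.filter (G.Adj u) := Finset.mem_filter.mpr ⟨hv, huv⟩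
    rw [Finset.mem_insert] at hu ⊢
    rcases hu with rfl | hu
    · exact Or.inr hvf
    by_cases hua : u = a
    · subst hua
      rw [fa, Finset.mem_insert, Finset.mem_singleton] at hvf
      rcases hvf with rfl | rfl
      exacts [Or.inr hbN, Or.inl rfl]
    by_cases hub : u = b
    · subst hub
      rw [fb, Finset.mem_insert, Finset.mem_singleton] at hvf
      rcases hvf with rfl | rfl
      exacts [Or.inr haN, Or.inl rfl]
    rw [fl u hu hua hub, Finset.mem_singleton] at hvf
    exact Or.inl hvf
  have hexR : ∑ u ∈ U \ insert c N, excess G U x u ≤ 0 := by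
    refine (sum_excess_le S.pathFree (fun v => (S.pos v).le) S.le_one Finset.sdiff_subset
      ?_).trans (Finset.sum_nonpos fun K hK => S.diamond_nonpos ?_)
    · intro u hu v hv huv
      rw [Finset.mem_sdiff] at hu ⊢
      exact ⟨hv, fun hvC => hu.2 (hclosed v hvC u hu.1 huv.symm)⟩
    · rw [mem_diamonds] at hK ⊢
      exact ⟨hK.1.trans Finset.sdiff_subset, hK.2⟩
  have hexU : ∑ u ∈ U, excess G U x u ≤ (L.card + 1) * x c + x a + x b - L.card - 3 := by
    rw [← Finset.sum_sdiff hCU, hexC]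
    linarith
  have hmiss0 : ∀ (w : V) (F : Finset V), F ⊆ U →
      ∑ u ∈ F, (1 - ind G u w) * x u ≤ ∑ u ∈ U, (1 - ind G u w) * x u := fun w F hF =>
    Finset.sum_le_sum_of_subset_of_nonneg hF fun u _ _ =>
      mul_nonneg (by linarith [ind_le_one G u w]) (S.pos u).le
  have haU := (hmU a).mpr ha
  have hbU := (hmU b).mpr hb
  have hcU := (hmU c).mpr hc
  rcases Finset.eq_empty_or_nonempty L with hL0 | ⟨l, hlL⟩
  · -- the component is a triangle
    have hN2 : N = {a, b} := (Finset.sdiff_eq_empty_iff_subset.mp hL0).antisymm habN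
    rw [hL0, Finset.card_empty] at hexU
    have hQ : ({a, b, c} : Finset V) ⊆ U := by
      intro v hv
      simp only [Finset.mem_insert, Finset.mem_singleton] at hv
      rcases hv with rfl | rfl | rfl <;> assumption
    have sum3 : ∀ g : V → ℝ, ∑ u ∈ ({a, b, c} : Finset V), g u = g a + g b + g c := by
      intro g
      rw [Finset.sum_insert (by simp [nab, nca.symm]), Finset.sum_pair ncb.symm, add_assoc]
    have hbud := S.budget hQ (Finset.card_le_three.trans (by norm_num))
    have hcut := S.le_cut hQ
    rw [sum3] at hcut
    rw [← hU, ← hN, fa, fb, hN2, Finset.sum_pair ncb.symm, Finset.sum_pair nca.symm,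
      Finset.sum_pair nab] at hcut
    have hbud' := hbud.trans (mul_le_mul_of_nonneg_left
      (show 1 + ∑ u ∈ U, excess G U x u ≤ x a + x b + x c - 2 by push_cast at hexU; linarith)
      (by linarith : (0 : ℝ) ≤ lam))
    have hq0 : ∀ w, 0 ≤ ∑ q ∈ ({a, b, c} : Finset V), ind G q w := fun w =>
      Finset.sum_nonneg fun q _ => ind_nonneg G q w
    have hmn : ∀ w, 0 ≤ ∑ u ∈ U, (1 - ind G u w) * x u := fun w =>
      Finset.sum_nonneg fun u _ => mul_nonneg (by linarith [ind_le_one G u w]) (S.pos u).le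
    have hs : 2 ≤ x a + x b + x c := by
      have := (Finset.sum_nonneg fun w _ => mul_nonneg (hq0 w) (hmn w)).trans hbud'
      have := nonneg_of_mul_nonneg_right this (by linarith)
      linarith
    by_cases hex : ∃ w ∈ far G h, G.Adj a w ∧ G.Adj b w ∧ G.Adj c w
    · obtain ⟨w0, hw0, haw0, hbw0, hcw0⟩ := hex
      obtain ⟨n0, f0⟩ := mem_far.mp hw0
      have two : ∀ p q r, G.Adj h p → G.Adj h q → G.Adj h r → G.Adj p q → G.Adj p r →
          G.Adj q r → G.Adj p w0 → G.Adj r w0 → ∀ w ∈ far G h, w ≠ w0 → G.Adj p w →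
          ¬ G.Adj q w := by
        intro p q r hp hq hr hpq hpr hqr hpw0 hrw0 w hw hne hpw hqw
        obtain ⟨n1, f1⟩ := mem_far.mp hw
        exact S.free.no_path hpw hpq hp.symm hpr hpw0 hqw.symm hq.symm hr hrw0 n1
          (by rintro rfl; exact f1 hr) hne hqr.ne (by rintro rfl; exact f0 hq) n0.symm
      have tab := two a b c ha hb hc hab hca.symm hcb.symm haw0 hcw0
      have tac := two a c b ha hc hb hca.symm hab hcb haw0 hbw0
      have tbc := two b c a hb hc ha hcb.symm hab.symm hca hbw0 haw0
      have hpt : ∀ w ∈ far G h, (∑ q ∈ ({a, b, c} : Finset V), ind G q w) *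
          (x a + x b + x c - 1) - (if w = w0 then 3 * (x a + x b + x c - 1) else 0) ≤
          (∑ q ∈ ({a, b, c} : Finset V), ind G q w) *
            ∑ u ∈ U, (1 - ind G u w) * x u := by
        intro w hw
        by_cases hww : w = w0
        · subst hww
          rw [if_pos rfl, sum3, ind_eq_one haw0, ind_eq_one hbw0, ind_eq_one hcw0]
          linarith [hmn w]
        · rw [if_neg hww, sub_zero]
          have h1 := tab w hw hww
          have h2 := tac w hw hww
          have h3 := tbc w hw hww
          have h4 := hmiss0 w _ hQ
          rw [sum3] at h4 ⊢
          by_cases ka : G.Adj a w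
          · rw [ind_eq_one ka, ind_eq_zero (h1 ka), ind_eq_zero (h2 ka)] at h4 ⊢
            linarith
          · by_cases kb : G.Adj b w
            · rw [ind_eq_zero ka, ind_eq_one kb, ind_eq_zero (h3 kb)] at h4 ⊢
              linarith
            · by_cases kc : G.Adj c w
              · rw [ind_eq_zero ka, ind_eq_zero kb, ind_eq_one kc] at h4 ⊢
                linarith
              · rw [ind_eq_zero ka, ind_eq_zero kb, ind_eq_zero kc]
                linarith
      have hsum := (Finset.sum_le_sum hpt).trans hbud'
      rw [Finset.sum_sub_distrib, ← Finset.sum_mul, Finset.sum_ite_eq', if_pos hw0] at hsum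
      have h5 : (lam - 2) * (x a + x b + x c) - 3 ≤
          ∑ w ∈ far G h, ∑ q ∈ ({a, b, c} : Finset V), ind G q w := by linarith
      have h6 := mul_le_mul_of_nonneg_right h5
        (by linarith : (0 : ℝ) ≤ x a + x b + x c - 1)
      set s := x a + x b + x c
      have hs3 : s ≤ 3 := by linarith
      have h7 : ((lam - 2) * s - 6) * (s - 1) ≤ lam * (s - 2) := by linarith
      have h8 : (2 * lam - 10) * (s - 1) ≤ lam * (s - 2) := by
        refine le_trans (mul_le_mul_of_nonneg_right ?_ (by linarith)) h7
        nlinarith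
      nlinarith
    · push Not at hex
      obtain ⟨z, hz0, hza, hzb, hzc, hzs⟩ : ∃ z, 0 < z ∧ z ≤ x a ∧ z ≤ x b ∧ z ≤ x c ∧
          x a + x b + x c - 2 ≤ z := by
        refine ⟨min (x a) (min (x b) (x c)), ?_, ?_, ?_, ?_, ?_⟩
        · simp [a0, b0, c0]
        · exact min_le_left _ _
        · exact (min_le_right _ _).trans (min_le_left _ _)
        · exact (min_le_right _ _).trans (min_le_right _ _)
        · simp only [le_min_iff]
          exact ⟨by linarith, by linarith, by linarith⟩
      have hpt : ∀ w ∈ far G h, (∑ q ∈ ({a, b, c} : Finset V), ind G q w) * z ≤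
          (∑ q ∈ ({a, b, c} : Finset V), ind G q w) *
            ∑ u ∈ U, (1 - ind G u w) * x u := by
        intro w hw
        refine mul_le_mul_of_nonneg_left (le_trans ?_ (hmiss0 w _ hQ)) (hq0 w)
        rw [sum3]
        have := hex w hw
        unfold ind
        split_ifs with ka kb kc <;> first | exact absurd kc (this ka kb) | linarith
      have hsum := (Finset.sum_le_sum hpt).trans hbud'
      rw [← Finset.sum_mul] at hsum
      have h5 : (lam - 2) * (x a + x b + x c) - 3 ≤ lam := by
        refine le_of_mul_le_mul_right ?_ hz0
        calc ((lam - 2) * (x a + x b + x c) - 3) * z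
            ≤ (∑ w ∈ far G h, ∑ q ∈ ({a, b, c} : Finset V), ind G q w) * z :=
              mul_le_mul_of_nonneg_right (by linarith) hz0.le
          _ ≤ lam * (x a + x b + x c - 2) := hsum
          _ ≤ lam * z := mul_le_mul_of_nonneg_left hzs (by linarith)
      nlinarith
  · have hlN : l ∈ N ∧ l ≠ a ∧ l ≠ b := by
      simpa only [hL, Finset.mem_sdiff, Finset.mem_insert, Finset.mem_singleton, not_or] using hlL
    obtain ⟨hlN, nla, nlb⟩ := hlN
    have hhl : G.Adj h l := (hmU l).mp (Finset.mem_filter.mp hlN).1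
    have hcl : G.Adj c l := (Finset.mem_filter.mp hlN).2
    have hcard : (1 : ℝ) ≤ L.card := by exact_mod_cast Finset.card_pos.mpr ⟨l, hlL⟩
    have hQ : ({a, b} : Finset V) ⊆ U := habN.trans (Finset.filter_subset _ _)
    have hbud := S.budget hQ (Finset.card_le_two.trans (by norm_num))
    have hcut := S.le_cut hQ
    rw [Finset.sum_pair nab] at hcut
    rw [← hU, fa, fb, Finset.sum_pair ncb.symm, Finset.sum_pair nca.symm] at hcut
    have hbud' := hbud.trans (mul_le_mul_of_nonneg_left
      (show 1 + ∑ u ∈ U, excess G U x u ≤ x a + x b + 2 * x c - 3 by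
        linarith [mul_nonneg (sub_nonneg.mpr hcard) (sub_nonneg.mpr c1)])
      (by linarith : (0 : ℝ) ≤ lam))
    have hmiss : ∀ p q, G.Adj h p → G.Adj h q → G.Adj c p → G.Adj c q → G.Adj p q → l ≠ p →
        l ≠ q → ∀ w ∈ far G h, G.Adj p w → ¬ G.Adj c w := by
      intro p q hp hq hcp hcq hpq nlp nlq w hw hpw hcw
      obtain ⟨n1, f1⟩ := mem_far.mp hw
      exact S.free.no_path hcw hcp hcq hc.symm hcl hpw.symm hpq hq.symm hhl
        (by rintro rfl; exact f1 hq) n1 (by rintro rfl; exact f1 hhl) hp.ne' nlp.symm nlq.symm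
    have hpt : ∀ w ∈ far G h, (∑ q ∈ ({a, b} : Finset V), ind G q w) * x c ≤
        (∑ q ∈ ({a, b} : Finset V), ind G q w) * ∑ u ∈ U, (1 - ind G u w) * x u := by
      intro w hw
      have h1 := hmiss a b ha hb hca hcb hab nla nlb w hw
      have h2 := hmiss b a hb ha hcb hca hab.symm nlb nla w hw
      have h3 := hmiss0 w {c} (by simpa using hcU)
      rw [Finset.sum_singleton] at h3
      rw [Finset.sum_pair nab]
      by_cases kc : G.Adj c w
      · rw [ind_eq_zero fun k => h1 k kc, ind_eq_zero fun k => h2 k kc]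
        simp
      · rw [ind_eq_zero kc] at h3
        exact mul_le_mul_of_nonneg_left (by linarith)
          (add_nonneg (ind_nonneg G a w) (ind_nonneg G b w))
    have hsum := (Finset.sum_le_sum hpt).trans hbud'
    rw [← Finset.sum_mul] at hsum
    have h5 := mul_le_mul_of_nonneg_right hcut c0.le
    set s := x a + x b
    have h6 : ((lam - 1) * s - 2 - 2 * x c) * x c ≤ lam * (s + 2 * x c - 3) := by
      refine le_trans (le_of_eq ?_) (h5.trans hsum)
      simp only [s]; ring
    have h7 : 0 ≤ (2 - s) * (lam * (1 - x c) + x c) :=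
      mul_nonneg (by linarith) (by nlinarith)
    nlinarith

end FanFreeEigen

/-- The adjacencies of `K_{1,r} + e` in a component of `G[U]` isomorphic to it. -/
theorem exists_starPlusEdge {V : Type*} {G : SimpleGraph V} {A : Set V}
    (C : (G.induce A).ConnectedComponent) {r : ℕ} (hr : 2 ≤ r)
    (e : (G.induce (Subtype.val '' C.supp)) ≃g starPlusEdge r) :
    ∃ a b c, a ∈ A ∧ b ∈ A ∧ c ∈ A ∧ G.Adj a b ∧ G.Adj c a ∧ G.Adj c b ∧
      (∀ v ∈ A, G.Adj a v → v = b ∨ v = c) ∧ (∀ v ∈ A, G.Adj b v → v = a ∨ v = c) ∧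
      ∀ v ∈ A, G.Adj c v → v ≠ a → v ≠ b → ∀ u ∈ A, G.Adj v u → u = c := by
  set T : Set V := Subtype.val '' C.supp with hT
  have hTA : ∀ v ∈ T, v ∈ A := by
    rintro _ ⟨v, -, rfl⟩
    exact v.2
  have hclosed : ∀ v ∈ T, ∀ u ∈ A, G.Adj v u → u ∈ T := by
    rintro _ ⟨v, hv, rfl⟩ u hu hvu
    refine ⟨⟨u, hu⟩, ?_, rfl⟩
    rw [SimpleGraph.ConnectedComponent.mem_supp_iff] at hv ⊢
    rw [← hv, SimpleGraph.ConnectedComponent.eq]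
    exact SimpleGraph.Adj.reachable (by simpa using hvu.symm)
  have v1 : ((1 : Fin (r + 1)) : ℕ) = 1 := by
    rw [Fin.val_one']; exact Nat.mod_eq_of_lt (by omega)
  have v2 : ((2 : Fin (r + 1)) : ℕ) = 2 := by
    rw [Fin.coe_ofNat_eq_mod]; exact Nat.mod_eq_of_lt (by omega)
  have n01 : (0 : Fin (r + 1)) ≠ 1 := by rw [ne_eq, Fin.ext_iff, v1]; simp
  have n02 : (0 : Fin (r + 1)) ≠ 2 := by rw [ne_eq, Fin.ext_iff, v2]; simp
  have n12 : (1 : Fin (r + 1)) ≠ 2 := by rw [ne_eq, Fin.ext_iff, v1, v2]; simp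
  have hadj : ∀ i j, (starPlusEdge r).Adj i j ↔ G.Adj (e.symm i).1 (e.symm j).1 := fun i j =>
    (e.symm.map_adj_iff (v := i) (w := j)).symm
  have hnbr : ∀ i, ∀ v ∈ A, G.Adj (e.symm i).1 v → ∃ j, v = (e.symm j).1 ∧
      (starPlusEdge r).Adj i j := by
    intro i v hv hiv
    have hvT := hclosed _ (e.symm i).2 v hv hiv
    refine ⟨e ⟨v, hvT⟩, by simp, ?_⟩
    rw [hadj]
    simpa using hiv
  refine ⟨(e.symm 1).1, (e.symm 2).1, (e.symm 0).1, hTA _ (e.symm 1).2, hTA _ (e.symm 2).2,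
    hTA _ (e.symm 0).2, ?_, ?_, ?_, ?_, ?_, ?_⟩
  · rw [← hadj]; simp [starPlusEdge, n12]
  · rw [← hadj]; simp [starPlusEdge, n01]
  · rw [← hadj]; simp [starPlusEdge, n02]
  · intro v hv h1
    obtain ⟨j, rfl, hj⟩ := hnbr 1 v hv h1
    simp only [starPlusEdge, SimpleGraph.fromRel_adj, n01.symm, n12, false_or, true_and,
      and_false, or_false] at hj
    rcases hj with ⟨-, rfl | rfl⟩ <;> simp
  · intro v hv h1
    obtain ⟨j, rfl, hj⟩ := hnbr 2 v hv h1
    simp only [starPlusEdge, SimpleGraph.fromRel_adj, n02.symm, n12.symm, false_or, and_true,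
      false_and] at hj
    rcases hj with ⟨-, rfl | rfl⟩ <;> simp
  · intro v hv h1 n1 n2 u hu hvu
    obtain ⟨j, rfl, hj⟩ := hnbr 0 v hv h1
    obtain ⟨k, rfl, hk⟩ := hnbr j u hu hvu
    have j1 : j ≠ 1 := by rintro rfl; exact n1 rfl
    have j2 : j ≠ 2 := by rintro rfl; exact n2 rfl
    have j0 : j ≠ 0 := hj.ne'
    simp only [starPlusEdge, SimpleGraph.fromRel_adj, j0, j1, j2, false_or, false_and, and_false,
      or_false] at hk
    rw [hk.2]

theorem stmt_19 
    {V : Type} [Fintype V] [DecidableEq V] (G : SimpleGraph V) [DecidableRel G.Adj]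
    (m : ℕ) (hm : 88 ≤ m)
    (hfree : F6Free G)
    (hcard : G.edgeSet.ncard = m)
    (hnoiso : ∀ v : V, ∃ w, G.Adj v w)
    (hmax : ∀ (n : ℕ) (G' : SimpleGraph (Fin n)), F6Free G' → G'.edgeSet.ncard = m →
      (∀ v, ∃ w, G'.Adj v w) → specRad G' ≤ specRad G)
    (lam : ℝ) (hlam : lam = specRad G)
    (hconn : G.Connected)
    (hlow : (1 + Real.sqrt (4 * (m : ℝ) - 3)) / 2 ≤ lam)
    (x : V → ℝ) (hxpos : ∀ v, 0 < x v)
    (heig : (G.adjMatrix ℝ).mulVec x = lam • x)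
    (ustar : V) (hustar : ∀ v, x v ≤ x ustar)
    :
    ∀ C : (G.induce (G.neighborSet ustar)).ConnectedComponent, ∀ r : ℕ, 2 ≤ r →
      ¬ Nonempty ((G.induce (Subtype.val '' C.supp)) ≃g starPlusEdge r) := by
  intro C r hr ⟨e⟩
  have hM : (88 : ℝ) ≤ m := by exact_mod_cast hm
  have hsqrt : 18.6 ≤ Real.sqrt (4 * (m : ℝ) - 3) := Real.le_sqrt_of_sq_le (by norm_num; linarith)
  have hsq := Real.sq_sqrt (show (0 : ℝ) ≤ 4 * (m : ℝ) - 3 by linarith)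
  have hm_le : (m : ℝ) ≤ lam ^ 2 - lam + 1 := by nlinarith
  have hx := hxpos ustar
  have hedges : ∑ v, ∑ w, ind G v w = 2 * m := by
    have h1 : ∀ v, ∑ w, ind G v w = (G.degree v : ℝ) := by
      intro v
      rw [← degIn_eq_sum, degIn, ← SimpleGraph.card_neighborFinset_eq_degree,
        SimpleGraph.neighborFinset_eq_filter]
      congr!
    simp only [h1]
    have h2 := G.sum_degrees_eq_twice_card_edges
    rw [← SimpleGraph.coe_edgeFinset, Set.ncard_coe_finset] at hcard
    rw [hcard] at h2
    exact_mod_cast h2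
  have S : FanFreeEigen G ustar (fun v => x v / x ustar) lam :=
    { free := hfree
      pos := fun v => div_pos (hxpos v) hx
      le_one := fun v => (div_le_one hx).mpr (hustar v)
      hub := div_self hx.ne'
      eig := fun u => by
        have h1 := congrFun heig u
        simp only [SimpleGraph.adjMatrix_mulVec_apply, Pi.smul_apply, smul_eq_mul] at h1
        rw [sum_ind_mul, ← Finset.sum_div, ← mul_div_assoc, ← h1,
          SimpleGraph.neighborFinset_eq_filter]
        congr!
      lam_ge := by linarith
      edges := by rw [hedges]; linarith }
  obtain ⟨a, b, c, ha, hb, hc, hab, hca, hcb, fa, fb, fl⟩ := exists_starPlusEdge C hr e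
  rw [SimpleGraph.mem_neighborSet] at ha hb hc
  refine S.no_starPlusEdge ha hb hc hab hca hcb ?_ ?_ ?_
  · ext v
    simp only [Finset.mem_filter, mem_near, Finset.mem_insert, Finset.mem_singleton]
    constructor
    · exact fun hv => fa v hv.1 hv.2
    · rintro (rfl | rfl)
      exacts [⟨hb, hab⟩, ⟨hc, hca.symm⟩]
  · ext v
    simp only [Finset.mem_filter, mem_near, Finset.mem_insert, Finset.mem_singleton]
    constructor
    · exact fun hv => fb v hv.1 hv.2
    · rintro (rfl | rfl)
      exacts [⟨ha, hab.symm⟩, ⟨hc, hcb.symm⟩]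
  · intro v hv nva nvb
    simp only [Finset.mem_filter, mem_near] at hv
    ext u
    simp only [Finset.mem_filter, mem_near, Finset.mem_singleton]
    constructor
    · exact fun hu => fl v hv.1 hv.2 nva nvb u hu.1 hu.2
    · rintro rfl
      exact ⟨hc, hv.2.symm⟩
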